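/- Let G be a finite group with conjugacy classes K_0, …, K_m and let P = ∏_{j=0}^{m} |K_j|. Then the degree χ(1) of every irreducible complex character χ of G divides P² · [G : G']. -/

import Mathlib

open CategoryTheory

/-- If `f ^ n = 1`, then `f` is diagonalizable with `n`-th roots of unity as eigenvalues, and the
trace of `f ^ k` is the corresponding sum, with multiplicities `m j`. -/
theorem exists_trace_pow_eq_sum {V : Type*} [AddCommGroup V] [Module ℂ V] [FiniteDimensional ℂ V]
    {n : ℕ} (hn : n ≠ 0) {ζ : ℂ} (hζ : IsPrimitiveRoot ζ n) {f : Module.End ℂ V} (hf : f ^ n = 1) :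
    ∃ m : ℕ → ℕ, ∀ k : ℕ,
      LinearMap.trace ℂ V (f ^ k) = ∑ j ∈ Finset.range n, (m j : ℂ) * (ζ ^ k) ^ j := by
  have hn' : (n : ℂ) ≠ 0 := Nat.cast_ne_zero.mpr hn
  have hζ0 : ζ ≠ 0 := hζ.ne_zero hn
  let e : ℕ → Module.End ℂ V := fun j ↦
    (n : ℂ)⁻¹ • ∑ i ∈ Finset.range n, ((ζ ^ j)⁻¹ • f) ^ i
  have hfe (j : ℕ) : f * e j = ζ ^ j • e j := by
    have h : ((ζ ^ j)⁻¹ • f - 1) * ∑ i ∈ Finset.range n, ((ζ ^ j)⁻¹ • f) ^ i = 0 := by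
      rw [mul_geom_sum, smul_pow, hf, inv_pow, ← pow_mul, mul_comm j, pow_mul, hζ.pow_eq_one]
      simp
    rw [sub_mul, one_mul, sub_eq_zero, smul_mul_assoc, inv_smul_eq_iff₀ (pow_ne_zero _ hζ0)] at h
    simp only [e, mul_smul_comm, h]
    rw [smul_comm]
  have hpow (j k : ℕ) : f ^ k * e j = (ζ ^ k) ^ j • e j := by
    induction k with
    | zero => simp
    | succ k ih =>
      rw [pow_succ', mul_assoc, ih, mul_smul_comm, hfe, smul_smul, pow_succ, mul_pow]
  have hidem (j : ℕ) : IsIdempotentElem (e j) := by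
    have h (i : ℕ) : ((ζ ^ j)⁻¹ • f) ^ i * e j = e j := by
      rw [smul_pow, smul_mul_assoc, hpow, smul_smul, inv_pow, ← pow_mul, ← pow_mul, mul_comm i,
        inv_mul_cancel₀ (pow_ne_zero _ hζ0), one_smul]
    change ((n : ℂ)⁻¹ • ∑ i ∈ Finset.range n, ((ζ ^ j)⁻¹ • f) ^ i) * e j = e j
    rw [smul_mul_assoc, Finset.sum_mul, Finset.sum_congr rfl fun i _ ↦ h i, Finset.sum_const,
      Finset.card_range, ← Nat.cast_smul_eq_nsmul ℂ, smul_smul, inv_mul_cancel₀ hn', one_smul]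
  have hsum : ∑ j ∈ Finset.range n, e j = 1 := by
    have h (i : ℕ) (hi : i ∈ Finset.range n) :
        ∑ j ∈ Finset.range n, ((ζ ^ j)⁻¹ • f) ^ i = if i = 0 then (n : ℂ) • 1 else 0 := by
      split_ifs with h0
      · simp [h0, Nat.cast_smul_eq_nsmul]
      · have h1 : ζ⁻¹ ^ i ≠ 1 := hζ.inv.pow_ne_one_of_pos_of_lt h0 (Finset.mem_range.mp hi)
        have h2 : ∑ j ∈ Finset.range n, (ζ⁻¹ ^ i) ^ j = 0 := by
          have := mul_geom_sum (ζ⁻¹ ^ i) n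
          rw [← pow_mul, mul_comm i, pow_mul, hζ.inv.pow_eq_one, one_pow, sub_self] at this
          exact (mul_eq_zero.mp this).resolve_left (sub_ne_zero.mpr h1)
        rw [← zero_smul ℂ (f ^ i), ← h2, Finset.sum_smul]
        refine Finset.sum_congr rfl fun j _ ↦ ?_
        rw [smul_pow, ← inv_pow, ← pow_mul, ← pow_mul, mul_comm]
    simp only [e]
    rw [← Finset.smul_sum, Finset.sum_comm, Finset.sum_congr rfl h, Finset.sum_ite_eq',
      if_pos (Finset.mem_range.mpr (Nat.pos_of_ne_zero hn)), smul_smul, inv_mul_cancel₀ hn',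
      one_smul]
  refine ⟨fun j ↦ Module.finrank ℂ (LinearMap.range (e j)), fun k ↦ ?_⟩
  rw [← mul_one (f ^ k), ← hsum, Finset.mul_sum, map_sum]
  refine Finset.sum_congr rfl fun j _ ↦ ?_
  rw [hpow, map_smul, (LinearMap.IsIdempotentElem.isProj_range _ (hidem j)).trace, smul_eq_mul,
    mul_comm]

namespace Representation

variable {G V : Type*} [Group G] [AddCommGroup V] [Module ℂ V]
  [FiniteDimensional ℂ V] (ρ : Representation ℂ G V)

/-- The values of a character on the powers of `g` are the same sums of powers of `ζ ^ k`. -/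
theorem exists_character_pow_eq_sum [Finite G] {ζ : ℂ} (hζ : IsPrimitiveRoot ζ (Nat.card G))
    (g : G) :
    ∃ m : ℕ → ℕ, ∀ k : ℕ,
      ρ.character (g ^ k) = ∑ j ∈ Finset.range (Nat.card G), (m j : ℂ) * (ζ ^ k) ^ j := by
  obtain ⟨m, hm⟩ := exists_trace_pow_eq_sum Nat.card_pos.ne' hζ (f := ρ g)
    (by rw [← map_pow, pow_card_eq_one', map_one])
  exact ⟨m, fun k ↦ by rw [character, map_pow, hm]⟩

theorem isIntegral_character [Finite G] (g : G) : IsIntegral ℤ (ρ.character g) := by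
  have hζ := Complex.isPrimitiveRoot_exp (Nat.card G) Nat.card_pos.ne'
  obtain ⟨m, hm⟩ := ρ.exists_character_pow_eq_sum hζ g
  rw [← pow_one g, hm]
  exact IsIntegral.sum _ fun j _ ↦
    (isIntegral_algebraMap (x := (m j : ℤ))).mul (((hζ.isIntegral Nat.card_pos).pow 1).pow j)

open ComplexConjugate in
theorem character_inv_eq_conj [Finite G] (g : G) : ρ.character g⁻¹ = conj (ρ.character g) := by
  have hζ := Complex.isPrimitiveRoot_exp (Nat.card G) Nat.card_pos.ne'
  obtain ⟨m, hm⟩ := ρ.exists_character_pow_eq_sum hζ g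
  have hinv : g⁻¹ = g ^ (Nat.card G - 1) := by
    rw [inv_eq_iff_mul_eq_one, ← pow_succ', Nat.sub_add_cancel Nat.card_pos, pow_card_eq_one']
  have h : Complex.exp (2 * Real.pi * Complex.I / Nat.card G) ^ (Nat.card G - 1) =
      conj (Complex.exp (2 * Real.pi * Complex.I / Nat.card G)) := by
    rw [← Complex.inv_eq_conj (hζ.norm'_eq_one Nat.card_pos.ne')]
    apply eq_inv_of_mul_eq_one_left
    rw [← pow_succ, Nat.sub_add_cancel Nat.card_pos, hζ.pow_eq_one]
  have h1 := hm 1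
  rw [pow_one] at h1
  rw [hinv, hm, h, h1, map_sum]
  simp

/-- The product of all values of a character is a rational integer, as it is Galois invariant. -/
theorem exists_int_prod_character [Fintype G] : ∃ a : ℤ, ∏ g, ρ.character g = a := by
  have : NeZero (Nat.card G) := ⟨Nat.card_pos.ne'⟩
  have : NeZero (Nat.card G : ℚ) := ⟨NeZero.ne _⟩
  obtain ⟨K, _, _, _⟩ : ∃ (K : Type) (_ : Field K) (_ : Algebra ℚ K),
      IsCyclotomicExtension {Nat.card G} ℚ K :=
    ⟨CyclotomicField (Nat.card G) ℚ, _, _, CyclotomicField.isCyclotomicExtension _ ℚ⟩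
  have : FiniteDimensional ℚ K := IsCyclotomicExtension.finiteDimensional {Nat.card G} ℚ K
  let φ : K →ₐ[ℚ] ℂ := IsAlgClosed.lift
  have hz : IsPrimitiveRoot (IsCyclotomicExtension.zeta (Nat.card G) ℚ K) (Nat.card G) :=
    IsCyclotomicExtension.zeta_spec _ ℚ K
  set z := IsCyclotomicExtension.zeta (Nat.card G) ℚ K
  choose m hm using ρ.exists_character_pow_eq_sum (ζ := φ z)
    (hz.map_of_injective φ.injective)
  let y : K := ∏ g, ∑ j ∈ Finset.range (Nat.card G), (m g j : K) * z ^ j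
  have hy : φ y = ∏ g, ρ.character g := by
    simp only [y, map_prod, map_sum, map_mul, map_natCast, map_pow]
    refine Finset.prod_congr rfl fun g _ ↦ ?_
    have := hm g 1
    simp only [pow_one] at this
    exact this.symm
  have : IsGalois ℚ K := IsCyclotomicExtension.isGalois {Nat.card G} ℚ K
  have hfix (σ : K ≃ₐ[ℚ] K) : σ y = y := by
    obtain ⟨k, -, hk, hσ⟩ := hz.isPrimitiveRoot_iff.mp (hz.map_of_injective σ.injective)
    apply φ.injective
    change φ (σ y) = φ y
    rw [hy]
    simp only [y, map_prod, map_sum, map_mul, map_natCast, map_pow, ← hσ, ← hm]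
    exact (powCoprime hk.symm).prod_comp ρ.character
  obtain ⟨q, hq⟩ := (IsGalois.mem_range_algebraMap_iff_fixed y).mpr hfix
  have hqy : (q : ℂ) = ∏ g, ρ.character g := by rw [← hy, ← hq]; simp
  have hint : IsIntegral ℤ (algebraMap ℚ ℂ q) := by
    change IsIntegral ℤ (q : ℂ)
    rw [hqy]
    exact IsIntegral.prod _ fun g _ ↦ ρ.isIntegral_character g
  rw [isIntegral_algebraMap_iff (algebraMap ℚ ℂ).injective] at hint
  obtain ⟨a, ha⟩ := IsIntegrallyClosed.isIntegral_iff.mp hint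
  exact ⟨a, by rw [← hqy, ← ha]; simp⟩

theorem sum_character_mul_inv [Fintype G] [IsIrreducible ρ] :
    ∑ g, ρ.character g * ρ.character g⁻¹ = Nat.card G := by
  have := invertibleOfNonzero (NeZero.ne (Nat.card G : ℂ))
  symm
  simpa [Nonempty.intro (Equiv.refl ρ), inv_mul_eq_one₀] using char_orthonormal ρ ρ

/-- Burnside's theorem on zeros of characters. -/
theorem exists_character_eq_zero [Finite G] [IsIrreducible ρ] (hd : Module.finrank ℂ V ≠ 1) :
    ∃ g, ρ.character g = 0 := by
  have := Fintype.ofFinite G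
  by_contra! hne
  have hpos (g : G) : 0 < Complex.normSq (ρ.character g) := Complex.normSq_pos.mpr (hne g)
  have hsum : ∑ g, Complex.normSq (ρ.character g) = Nat.card G := by
    have h := ρ.sum_character_mul_inv
    simp_rw [character_inv_eq_conj, Complex.mul_conj] at h
    exact_mod_cast h
  have hprod : 1 ≤ ∏ g, Complex.normSq (ρ.character g) := by
    obtain ⟨a, ha⟩ := ρ.exists_int_prod_character
    have ha0 : a ≠ 0 := by
      rintro rfl
      exact Finset.prod_ne_zero_iff.mpr (fun g _ ↦ hne g) (by simpa using ha)
    rw [← map_prod, ha, Complex.normSq_intCast]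
    have : 1 ≤ a * a := by nlinarith [mul_self_pos.mpr ha0]
    exact_mod_cast this
  have hlog : 0 ≤ ∑ g, Real.log (Complex.normSq (ρ.character g)) := by
    rw [← Real.log_prod fun g _ ↦ (hpos g).ne']
    exact Real.log_nonneg hprod
  have hlt : ∑ g, Real.log (Complex.normSq (ρ.character g)) <
      ∑ g, (Complex.normSq (ρ.character g) - 1) := by
    refine Finset.sum_lt_sum (fun g _ ↦ Real.log_le_sub_one_of_pos (hpos g))
      ⟨1, Finset.mem_univ _, Real.log_lt_sub_one_of_pos (hpos 1) ?_⟩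
    rw [char_one, Complex.normSq_natCast]
    norm_cast
    exact fun h ↦ hd (Nat.mul_self_inj.mp (h.trans (one_mul 1).symm))
  rw [Finset.sum_sub_distrib, hsum] at hlt
  simp only [Finset.sum_const, Finset.card_univ, nsmul_eq_mul, mul_one, Nat.card_eq_fintype_card,
    sub_self] at hlt
  exact hlt.not_ge hlog

omit [FiniteDimensional ℂ V] in
/-- Schur's lemma, for a representation whose commutant is one-dimensional. -/
theorem exists_eq_smul_one_of_commute (hρ : Module.finrank ℂ (IntertwiningMap ρ ρ) = 1)
    {f : Module.End ℂ V} (hf : ∀ g, Commute f (ρ g)) : ∃ c : ℂ, f = c • 1 := by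
  obtain ⟨v, hv, hspan⟩ := finrank_eq_one_iff'.mp hρ
  let i : IntertwiningMap ρ ρ := ⟨LinearMap.id, fun g ↦ rfl⟩
  let F : IntertwiningMap ρ ρ := ⟨f, hf⟩
  obtain ⟨a, ha⟩ := hspan i
  obtain ⟨b, hb⟩ := hspan F
  have ha' : a • v.toLinearMap = LinearMap.id := congrArg IntertwiningMap.toLinearMap ha
  have hb' : b • v.toLinearMap = f := congrArg IntertwiningMap.toLinearMap hb
  by_cases ha0 : a = 0
  · refine ⟨0, ?_⟩
    have h : (1 : Module.End ℂ V) = 0 := by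
      rw [ha0, zero_smul] at ha'
      exact ha'.symm
    rw [← mul_one f, h, mul_zero, smul_zero]
  · refine ⟨b * a⁻¹, ?_⟩
    rw [Module.End.one_eq_id, ← ha', smul_smul, inv_mul_cancel_right₀ ha0, hb']

omit [FiniteDimensional ℂ V] in
theorem nontrivial_of_finrank_intertwiningMap_eq_one
    (hρ : Module.finrank ℂ (IntertwiningMap ρ ρ) = 1) : Nontrivial V := by
  by_contra h
  rw [not_nontrivial_iff_subsingleton] at h
  have : Subsingleton (IntertwiningMap ρ ρ) :=
    ⟨fun f g ↦ DFunLike.ext f g fun _ ↦ Subsingleton.elim _ _⟩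
  rw [Module.finrank_zero_of_subsingleton] at hρ
  exact zero_ne_one hρ

/-- The degree of an irreducible representation divides the order of the group. -/
theorem finrank_dvd_card [Finite G]
    (hρ : Module.finrank ℂ (IntertwiningMap ρ ρ) = 1) :
    Module.finrank ℂ V ∣ Nat.card G := by
  have := nontrivial_of_finrank_intertwiningMap_eq_one ρ hρ
  have := Fintype.ofFinite G
  have := invertibleOfNonzero (NeZero.ne (Nat.card G : ℂ))
  let A := integralClosure ℤ ℂ
  let a : G → A := fun g ↦ ⟨ρ.character g⁻¹, ρ.isIntegral_character g⁻¹⟩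
  let s : MonoidAlgebra A G := ∑ g, MonoidAlgebra.single g (a g)
  have hs : IsIntegral ℤ s := by
    have : Module.Finite A (MonoidAlgebra A G) := inferInstance
    exact isIntegral_trans (A := A) s (Algebra.IsIntegral.isIntegral s)
  let ψ : MonoidAlgebra A G →+* Module.End ℂ V :=
    (asAlgebraHom ρ).toRingHom.comp (MonoidAlgebra.mapRingHom G (algebraMap A ℂ))
  have hψ : ψ s = ∑ g, ρ.character g⁻¹ • ρ g := by
    simp [ψ, s, a, MonoidAlgebra.mapRingHom]
  have hcomm (h : G) : Commute (ψ s) (ρ h) := by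
    rw [hψ, commute_iff_eq, Finset.sum_mul, Finset.mul_sum]
    refine Fintype.sum_equiv (MulAut.conj h⁻¹).toEquiv _ _ fun g ↦ ?_
    have hg : ρ.character (h⁻¹ * (g⁻¹ * h)) = ρ.character g⁻¹ := by
      simpa [mul_assoc] using ρ.char_conj g⁻¹ h⁻¹
    simp [← map_mul, mul_assoc, hg]
  obtain ⟨c, hc⟩ := ρ.exists_eq_smul_one_of_commute hρ hcomm
  have hd : (Module.finrank ℂ V : ℂ) ≠ 0 := Nat.cast_ne_zero.mpr Module.finrank_pos.ne'
  have hcard : c * Module.finrank ℂ V = Nat.card G := by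
    have h := ρ.card_inv_mul_sum_char_mul_char_eq_finrank ρ
    rw [hρ, Nat.cast_one, inv_mul_eq_one₀ (NeZero.ne _)] at h
    rw [h, ← smul_eq_mul, ← LinearMap.trace_one (R := ℂ) (M := V), ← map_smul, ← hc, hψ]
    simp [character, mul_comm]
  have hint : IsIntegral ℤ c := by
    have h1 : IsIntegral ℤ (algebraMap ℂ (Module.End ℂ V) c) := by
      rw [Algebra.algebraMap_eq_smul_one, ← hc]
      exact map_isIntegral_int ψ hs
    exact (isIntegral_algebraMap_iff (algebraMap ℂ (Module.End ℂ V)).injective).mp h1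
  have hq : c = algebraMap ℚ ℂ (Nat.card G / Module.finrank ℂ V) := by
    rw [eq_div_of_mul_eq hd hcard]
    simp
  rw [hq, isIntegral_algebraMap_iff (algebraMap ℚ ℂ).injective] at hint
  obtain ⟨b, hb⟩ := IsIntegrallyClosed.isIntegral_iff.mp hint
  rw [← Int.natCast_dvd_natCast]
  refine ⟨b, ?_⟩
  rw [eq_div_iff (by exact_mod_cast hd)] at hb
  simp only [algebraMap_int_eq, eq_intCast] at hb
  rw [mul_comm]
  exact_mod_cast hb.symm

end Representation

open Classical in
/-- The sum of the elements of a conjugacy class, in the monoid algebra. -/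
noncomputable def ConjClasses.sum {G : Type*} [Group G] [Fintype G] (R : Type*) [Semiring R]
    (c : ConjClasses G) : MonoidAlgebra R G :=
  ∑ x with ConjClasses.mk x = c, MonoidAlgebra.single x 1

namespace Representation

variable {G V : Type*} [Group G] [AddCommGroup V] [Module ℂ V]
  [FiniteDimensional ℂ V] (ρ : Representation ℂ G V)

open Classical in
/-- A class sum on which an irreducible character vanishes acts as zero. -/
theorem asAlgebraHom_conjClasses_sum_eq_zero [Fintype G] [IsIrreducible ρ] {g : G}
    (hg : ρ.character g = 0) : ρ.asAlgebraHom ((ConjClasses.mk g).sum ℂ) = 0 := by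
  have := nontrivial_of_finrank_intertwiningMap_eq_one ρ
    (IsIrreducible.finrank_intertwiningMap_self ρ)
  have hsum : ρ.asAlgebraHom ((ConjClasses.mk g).sum ℂ) =
      ∑ x with ConjClasses.mk x = ConjClasses.mk g, ρ x := by
    simp [ConjClasses.sum]
  have hcomm (h : G) : Commute (ρ.asAlgebraHom ((ConjClasses.mk g).sum ℂ)) (ρ h) := by
    rw [hsum, commute_iff_eq, Finset.sum_mul, Finset.mul_sum]
    refine Finset.sum_equiv (MulAut.conj h⁻¹).toEquiv (fun x ↦ ?_) fun x _ ↦ ?_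
    · have : ConjClasses.mk (h⁻¹ * x * h⁻¹⁻¹) = ConjClasses.mk x :=
        (ConjClasses.mk_eq_mk_iff_isConj.mpr (isConj_iff.mpr ⟨h⁻¹, rfl⟩)).symm
      simp only [Finset.mem_filter, Finset.mem_univ, true_and, MulEquiv.toEquiv_eq_coe,
        EquivLike.coe_coe, MulAut.conj_apply, this]
    · simp [← map_mul, mul_assoc]
  obtain ⟨c, hc⟩ := ρ.exists_eq_smul_one_of_commute
    (IsIrreducible.finrank_intertwiningMap_self ρ) hcomm
  have htr : LinearMap.trace ℂ V (ρ.asAlgebraHom ((ConjClasses.mk g).sum ℂ)) = 0 := by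
    rw [hsum, map_sum]
    refine Finset.sum_eq_zero fun x hx ↦ ?_
    obtain ⟨h, hh⟩ := isConj_iff.mp (ConjClasses.mk_eq_mk_iff_isConj.mp
      (Finset.mem_filter.mp hx).2).symm
    rw [← hh]
    exact (ρ.char_conj g h).trans hg
  rw [hc, map_smul, LinearMap.trace_one, smul_eq_mul, mul_eq_zero] at htr
  rw [hc, htr.resolve_right (Nat.cast_ne_zero.mpr Module.finrank_pos.ne'), zero_smul]

omit [FiniteDimensional ℂ V] in
theorem apply_eq_one_of_mem_commutator (hd : Module.finrank ℂ V = 1) {h : G}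
    (hh : h ∈ commutator G) : ρ h = 1 := by
  have hcomm (f f' : Module.End ℂ V) : f * f' = f' * f := by
    obtain ⟨v, -, hv⟩ := finrank_eq_one_iff'.mp hd
    ext w
    obtain ⟨a, ha⟩ := hv (f v)
    obtain ⟨b, hb⟩ := hv (f' v)
    obtain ⟨c, rfl⟩ := hv w
    simp [← ha, ← hb, smul_comm a b]
  have hle : commutator G ≤ ρ.ker := by
    rw [commutator_def, Subgroup.commutator_le]
    intro a _ b _
    rw [MonoidHom.mem_ker, commutatorElement_def, map_mul, map_mul, map_mul, hcomm (ρ a), mul_assoc,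
      mul_assoc, ← mul_assoc (ρ a), ← map_mul, mul_inv_cancel, map_one, one_mul, ← map_mul,
      mul_inv_cancel, map_one]
  exact hle hh

end Representation

section

universe u

variable (G : Type u) [Group G] [Fintype G]

open Classical in
/-- The product of all conjugacy class sums. -/
noncomputable def conjClassesSumProd (R : Type*) [Semiring R] : MonoidAlgebra R G :=
  ((Finset.univ : Finset (ConjClasses G)).toList.map (ConjClasses.sum R)).prod

variable {G}

/-- The product of the class sums absorbs the derived subgroup in every irreducible
representation: nonlinear ones kill it by Burnside's theorem. -/
theorem asAlgebraHom_conjClassesSumProd_mul_single {V : Type*} [AddCommGroup V] [Module ℂ V]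
    [FiniteDimensional ℂ V] (ρ : Representation ℂ G V) [ρ.IsIrreducible] {h : G}
    (hh : h ∈ commutator G) :
    ρ.asAlgebraHom (conjClassesSumProd G ℂ * MonoidAlgebra.single h 1) =
      ρ.asAlgebraHom (conjClassesSumProd G ℂ) := by
  rw [map_mul]
  by_cases hd : Module.finrank ℂ V = 1
  · rw [Representation.asAlgebraHom_single_one, ρ.apply_eq_one_of_mem_commutator hd hh, mul_one]
  · obtain ⟨g, hg⟩ := ρ.exists_character_eq_zero hd
    suffices h0 : ρ.asAlgebraHom (conjClassesSumProd G ℂ) = 0 by rw [h0, zero_mul]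
    rw [conjClassesSumProd, map_list_prod, List.map_map]
    refine List.prod_eq_zero (List.mem_map.mpr ⟨ConjClasses.mk g, ?_, ?_⟩)
    · simp
    · exact ρ.asAlgebraHom_conjClasses_sum_eq_zero hg

theorem smul_eq_smul_of_forall_isIrreducible {a b : MonoidAlgebra ℂ G}
    (h : ∀ (V : Type u) [AddCommGroup V] [Module ℂ V] [FiniteDimensional ℂ V]
      (ρ : Representation ℂ G V) [ρ.IsIrreducible], ρ.asAlgebraHom a = ρ.asAlgebraHom b)
    (M : Type u) [AddCommGroup M] [Module (MonoidAlgebra ℂ G) M]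
    [IsSimpleModule (MonoidAlgebra ℂ G) M] [Module.Finite (MonoidAlgebra ℂ G) M] (x : M) :
    a • x = b • x := by
  have hirr := (Representation.isSimpleModule_iff_irreducible_ofModule (k := ℂ) (G := G) M).mp
    inferInstance
  let e := RestrictScalars.addEquiv ℂ (MonoidAlgebra ℂ G) M
  have hfin : @Module.Finite ℂ (RestrictScalars ℂ (MonoidAlgebra ℂ G) M) _ _
      (RestrictScalars.module ℂ (MonoidAlgebra ℂ G) M) := by
    let := RestrictScalars.moduleOrig ℂ (MonoidAlgebra ℂ G) M
    have : Module.Finite (MonoidAlgebra ℂ G) (RestrictScalars ℂ (MonoidAlgebra ℂ G) M) :=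
      inferInstanceAs (Module.Finite (MonoidAlgebra ℂ G) M)
    exact Module.Finite.trans (MonoidAlgebra ℂ G) (RestrictScalars ℂ (MonoidAlgebra ℂ G) M)
  have key := @h (RestrictScalars ℂ (MonoidAlgebra ℂ G) M) inferInstance
    (RestrictScalars.module ℂ (MonoidAlgebra ℂ G) M) hfin (Representation.ofModule M) hirr
  have key' := congrArg
    (fun f : Module.End ℂ (RestrictScalars ℂ (MonoidAlgebra ℂ G) M) ↦ f (e.symm x)) key
  exact e.symm.injective <|
    (Representation.ofModule_asAlgebraHom_apply_apply M a _).symm.trans <|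
      key'.trans (Representation.ofModule_asAlgebraHom_apply_apply M b _)

/-- Elements of the complex group algebra are determined by their action on the irreducible
representations. -/
theorem MonoidAlgebra.eq_of_forall_isIrreducible {a b : MonoidAlgebra ℂ G}
    (h : ∀ (V : Type u) [AddCommGroup V] [Module ℂ V] [FiniteDimensional ℂ V]
      (ρ : Representation ℂ G V) [ρ.IsIrreducible], ρ.asAlgebraHom a = ρ.asAlgebraHom b) :
    a = b := by
  rw [← mul_one a, ← mul_one b]
  have hmem : (1 : MonoidAlgebra ℂ G) ∈
      sSup {S : Submodule (MonoidAlgebra ℂ G) (MonoidAlgebra ℂ G) |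
        IsSimpleModule (MonoidAlgebra ℂ G) S} := by
    rw [IsSemisimpleModule.sSup_simples_eq_top]
    trivial
  rw [sSup_eq_iSup'] at hmem
  refine Submodule.iSup_induction _ (motive := fun x ↦ a * x = b * x) hmem ?_ (by simp)
    fun x y hx hy ↦ by rw [mul_add, mul_add, hx, hy]
  rintro ⟨S, hS⟩ x hx
  have : IsSimpleModule (MonoidAlgebra ℂ G) S := hS
  exact congrArg Subtype.val (smul_eq_smul_of_forall_isIrreducible h S ⟨x, hx⟩)

theorem map_conjClassesSumProd {R S : Type*} [Semiring R] [Semiring S] (f : R →+* S) :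
    MonoidAlgebra.mapRingHom G f (conjClassesSumProd G R) = conjClassesSumProd G S := by
  rw [conjClassesSumProd, map_list_prod, List.map_map, conjClassesSumProd]
  congr 2
  ext1 c
  rw [Function.comp_apply, ConjClasses.sum, map_sum, ConjClasses.sum]
  simp

theorem lift_one_conjClassesSumProd :
    MonoidAlgebra.lift ℕ ℕ G 1 (conjClassesSumProd G ℕ) =
      ∏ᶠ c : ConjClasses G, Nat.card c.carrier := by
  classical
  rw [conjClassesSumProd, map_list_prod, List.map_map, Finset.prod_map_toList,
    finprod_eq_prod_of_fintype]
  refine Finset.prod_congr rfl fun c _ ↦ ?_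
  have hc : c.carrier = ↑({x | ConjClasses.mk x = c} : Finset G) := by
    ext x
    simp [ConjClasses.mem_carrier_iff_mk_eq]
  rw [Function.comp_apply, ConjClasses.sum, map_sum, hc, Nat.card_coe_set_eq,
    Set.ncard_coe_finset]
  simp only [MonoidAlgebra.lift_single, MonoidHom.one_apply, smul_eq_mul, mul_one,
    Finset.card_eq_sum_ones]

theorem Subgroup.card_dvd_sum_of_forall_mul_right (H : Subgroup G) (f : G → ℕ)
    (hf : ∀ g, ∀ h ∈ H, f (g * h) = f g) : Nat.card H ∣ ∑ g, f g := by
  classical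
  have : Fintype (G ⧸ H) := Fintype.ofFinite _
  have : Fintype H := Fintype.ofFinite _
  have h (g : G) : f g = f (Subgroup.groupEquivQuotientProdSubgroup (s := H) g).1.out := by
    obtain ⟨x, hx⟩ := QuotientGroup.mk_out_eq_mul H g
    exact (hf g x x.2).symm.trans (congrArg f hx.symm)
  rw [Finset.sum_congr rfl fun g _ ↦ h g,
    (Subgroup.groupEquivQuotientProdSubgroup (s := H)).sum_comp fun p ↦ f p.1.out,
    Fintype.sum_prod_type]
  simp [← Finset.mul_sum]

/-- The order of the derived subgroup divides the product of the sizes of the conjugacy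
classes. -/
theorem card_commutator_dvd_prod_conjClasses :
    Nat.card (commutator G) ∣ ∏ᶠ c : ConjClasses G, Nat.card c.carrier := by
  have hinv (h : G) (hh : h ∈ commutator G) :
      conjClassesSumProd G ℕ * MonoidAlgebra.single h 1 = conjClassesSumProd G ℕ := by
    have hC : conjClassesSumProd G ℂ * MonoidAlgebra.single h 1 = conjClassesSumProd G ℂ :=
      MonoidAlgebra.eq_of_forall_isIrreducible fun _ _ _ _ ρ _ ↦
        asAlgebraHom_conjClassesSumProd_mul_single ρ hh
    rw [← map_conjClassesSumProd (Nat.castRingHom ℂ)] at hC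
    have hs : (MonoidAlgebra.single h 1 : MonoidAlgebra ℂ G) =
        MonoidAlgebra.mapRingHom G (Nat.castRingHom ℂ) (MonoidAlgebra.single h 1) := by
      simp
    rw [hs, ← map_mul] at hC
    ext g
    have hg := congrArg (fun z : MonoidAlgebra ℂ G ↦ z.coeff g) hC
    simp only [MonoidAlgebra.coeff_mapRingHom] at hg
    exact Nat.cast_injective hg
  rw [← lift_one_conjClassesSumProd]
  have hsum : MonoidAlgebra.lift ℕ ℕ G 1 (conjClassesSumProd G ℕ) =
      ∑ g, (conjClassesSumProd G ℕ).coeff g := by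
    rw [MonoidAlgebra.lift_apply, Finsupp.sum_fintype _ _ (by simp)]
    simp
  rw [hsum]
  refine Subgroup.card_dvd_sum_of_forall_mul_right _ _ fun g h hh ↦ ?_
  nth_rw 1 [← hinv h hh]
  simp

end

theorem FDRep.finrank_intertwiningMap {G : Type} [Group G] [Finite G] (V : FDRep ℂ G)
    (hV : Simple V) :
    Module.finrank ℂ (Representation.IntertwiningMap V.ρ V.ρ) = 1 := by
  have := Fintype.ofFinite G
  have := invertibleOfNonzero (NeZero.ne (Nat.card G : ℂ))
  have h := (FDRep.simple_iff_char_is_norm_one V).mp hV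
  have h' := Representation.card_inv_mul_sum_char_mul_char_eq_finrank V.ρ V.ρ
  change _ * ∑ g : G, V.character g * V.character g⁻¹ = _ at h'
  rw [h, inv_mul_cancel₀ (NeZero.ne _)] at h'
  exact_mod_cast h'.symm

/-- Let `G` be a finite group with conjugacy classes `K_0, …, K_m` and
`P = ∏ |K_j|`. Then the degree of every irreducible complex character of `G` divides
`P² · [G : G']`. -/
theorem irrep_degree_dvd_prod_conjClasses_sq_mul_index
    {G : Type} [Group G] [Finite G] (V : FDRep ℂ G) (hV : Simple V) :
    Module.finrank ℂ V ∣
      (∏ᶠ c : ConjClasses G, Nat.card c.carrier) ^ 2 * (commutator G).index := by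
  have := Fintype.ofFinite G
  have hρ := V.finrank_intertwiningMap hV
  refine (Representation.finrank_dvd_card V.ρ hρ).trans ?_
  rw [← (commutator G).card_mul_index]
  exact mul_dvd_mul_right
    (card_commutator_dvd_prod_conjClasses.trans (dvd_pow_self _ two_ne_zero)) _
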